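/- (Lemma 2.7) Under the holonomic system hypotheses with the conformally flat constant-mean-curvature ansatz, if v1(p) ≠ v3(p) at some point p ∈ U, then H = 0 and c = 0. -/

import Mathlib

noncomputable section

/-- Partial derivative of `f : ℝ³ → ℝ` in the `i`-th coordinate direction `u_{i+1}`. -/
noncomputable def pd (i : Fin 3) (f : (Fin 3 → ℝ) → ℝ) (p : Fin 3 → ℝ) : ℝ :=
  fderiv ℝ f p (Pi.single i 1)

/-- `hh v i j p = h_{ij}(p) = (1/v_i) ∂v_j/∂u_i` (indices shifted down by one:
`v 0, v 1, v 2` are `v₁, v₂, v₃` and directions `0,1,2` are `u₁,u₂,u₃`). -/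
noncomputable def hh (v : Fin 3 → (Fin 3 → ℝ) → ℝ) (i j : Fin 3) (p : Fin 3 → ℝ) : ℝ :=
  (1 / v i p) * pd i (v j) p

/-- `al v 0 = α₁ = (1/v₂)∂v₂/∂u₁`, `al v 1 = α₂ = (1/v₃)∂v₃/∂u₂`,
`al v 2 = α₃ = (1/v₁)∂v₁/∂u₃`. -/
noncomputable def al (v : Fin 3 → (Fin 3 → ℝ) → ℝ) (i : Fin 3) (p : Fin 3 → ℝ) : ℝ :=
  (1 / v (i + 1) p) * pd i (v (i + 1)) p

/-- The holonomic system hypotheses together with the conformally flat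
constant-mean-curvature ansatz, on a connected open set `U ⊆ ℝ³`. -/
structure Hypo (U : Set (Fin 3 → ℝ)) (v V : Fin 3 → (Fin 3 → ℝ) → ℝ) (c H : ℝ) : Prop where
  hopen : IsOpen U
  hconn : IsConnected U
  smooth_v : ∀ i, ContDiffOn ℝ (⊤ : ℕ∞) (v i) U
  smooth_V : ∀ i, ContDiffOn ℝ (⊤ : ℕ∞) (V i) U
  pos : ∀ i, ∀ p ∈ U, 0 < v i p
  holi : ∀ i j, i ≠ j → ∀ p ∈ U, pd j (v i) p = hh v j i p * v j p
  holii : ∀ i j k, i ≠ j → j ≠ k → i ≠ k → ∀ p ∈ U,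
    pd j (hh v i k) p = hh v i j p * hh v j k p
  holiii : ∀ i j k, i ≠ j → j ≠ k → i ≠ k → ∀ p ∈ U,
    pd i (hh v i j) p + pd j (hh v j i) p + hh v k i p * hh v k j p
      + V i p * V j p + c * v i p * v j p = 0
  holiv : ∀ i j, i ≠ j → ∀ p ∈ U, pd j (V i) p = hh v j i p * V j p
  ansatz_v : ∀ p ∈ U, (v 1 p) ^ 2 = (v 0 p) ^ 2 + (v 2 p) ^ 2
  ansatz_V1 : ∀ p ∈ U, V 0 p = -(1/3) * (v 1 p / v 2 p + v 2 p / v 1 p) + (v 0 p / 3) * H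
  ansatz_V2 : ∀ p ∈ U, V 1 p = -(1/3) * (v 0 p / v 2 p - v 2 p / v 0 p) + (v 1 p / 3) * H
  ansatz_V3 : ∀ p ∈ U, V 2 p = (1/3) * (v 0 p / v 1 p + v 1 p / v 0 p) + (v 2 p / 3) * H


/-- `HasPD i f d q`: at `q`, the function `f` has partial derivative `d` in direction `i`. -/
def HasPD (i : Fin 3) (f : (Fin 3 → ℝ) → ℝ) (d : ℝ) (q : Fin 3 → ℝ) : Prop :=
  HasLineDerivAt ℝ f d q (Pi.single i 1)

namespace HasPD

variable {i : Fin 3} {f g : (Fin 3 → ℝ) → ℝ} {d e : ℝ} {q : Fin 3 → ℝ}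

theorem unique (hf : HasPD i f d q) (hf' : HasPD i f e q) : d = e :=
  HasLineDerivAt.unique hf hf'

theorem const (r : ℝ) : HasPD i (fun _ => r) 0 q :=
  hasDerivAt_const _ _

theorem add (hf : HasPD i f d q) (hg : HasPD i g e q) :
    HasPD i (fun x => f x + g x) (d + e) q :=
  HasDerivAt.fun_add hf hg

theorem sub (hf : HasPD i f d q) (hg : HasPD i g e q) :
    HasPD i (fun x => f x - g x) (d - e) q :=
  HasDerivAt.fun_sub hf hg

theorem neg (hf : HasPD i f d q) : HasPD i (fun x => -f x) (-d) q :=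
  HasDerivAt.fun_neg hf

theorem mul (hf : HasPD i f d q) (hg : HasPD i g e q) :
    HasPD i (fun x => f x * g x) (d * g q + f q * e) q := by
  simpa [HasPD, HasLineDerivAt] using HasDerivAt.fun_mul hf hg

theorem div (hf : HasPD i f d q) (hg : HasPD i g e q) (h : g q ≠ 0) :
    HasPD i (fun x => f x / g x) ((d * g q - f q * e) / g q ^ 2) q := by
  simpa [HasPD, HasLineDerivAt] using HasDerivAt.fun_div hf hg (by simpa using h)

theorem pow (hf : HasPD i f d q) (n : ℕ) :
    HasPD i (fun x => f x ^ n) (n * f q ^ (n - 1) * d) q := by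
  simpa [HasPD, HasLineDerivAt] using HasDerivAt.fun_pow hf n

theorem smul (hf : HasPD i f d q) (r : ℝ) : HasPD i (fun x => r * f x) (r * d) q :=
  HasDerivAt.const_mul r hf

theorem congr {W : Set (Fin 3 → ℝ)} (hf : HasPD i f d q) (hW : IsOpen W) (hq : q ∈ W)
    (h : ∀ x ∈ W, g x = f x) : HasPD i g d q :=
  HasLineDerivAt.congr_of_eventuallyEq hf (Filter.eventually_of_mem (hW.mem_nhds hq) h)

theorem eq_zero {W : Set (Fin 3 → ℝ)} (hf : HasPD i f d q) (hW : IsOpen W) (hq : q ∈ W)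
    (h : ∀ x ∈ W, f x = 0) : d = 0 :=
  hf.unique ((const 0).congr hW hq h)

end HasPD

theorem DifferentiableAt.hasPD {f : (Fin 3 → ℝ) → ℝ} {q : Fin 3 → ℝ}
    (h : DifferentiableAt ℝ f q) (i : Fin 3) : HasPD i f (pd i f q) q :=
  h.hasFDerivAt.hasLineDerivAt _

/-- `(i, j, k)` is a cyclic permutation of `(0, 1, 2)`. -/
def Cyc (i j k : Fin 3) : Prop := j = i + 1 ∧ k = i + 2

instance (i j k : Fin 3) : Decidable (Cyc i j k) := inferInstanceAs (Decidable (_ ∧ _))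

theorem Cyc.rot : ∀ {i j k : Fin 3}, Cyc i j k → Cyc j k i := by decide

theorem Cyc.distinct : ∀ {i j k : Fin 3}, Cyc i j k → i ≠ j ∧ j ≠ k ∧ i ≠ k := by decide

theorem cyc_succ (i : Fin 3) : Cyc i (i + 1) (i + 2) := ⟨rfl, rfl⟩

theorem cyc_or_cyc_of_distinct : ∀ {i j k : Fin 3}, i ≠ j → j ≠ k → i ≠ k →
    Cyc i j k ∨ Cyc i k j := by decide

/-- The term `(V_i V_j / (v_i v_j) + c) / (a_i a_j)²` of the Gauss equation, in terms of
`x = a_i`, `y = a_j`, `z = a_k`, `t = H / (3 v₁ v₂ v₃)` and `K = H² / 9 + c`. -/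
noncomputable def gaussTerm (x y z t K : ℝ) : ℝ :=
  (-((y - z) * (z - x)) / (9 * (x * (y * z))) - (x - y) * t / 3 + K) / (x ^ 2 * y ^ 2)

/-- The holonomic system in the unknowns `a_i = ± v_i²` and `p_i`, where
`∂_i log v_j = p_i a_j²` for `j ≠ i`, together with `s_i = p_i² / (v_i² a_i²)`,
`F_i = ∂_i p_i / (v_i² a_i²)` and `t = H / (3 v₁ v₂ v₃)`. -/
structure Reduced (U : Set (Fin 3 → ℝ)) (a p s F : Fin 3 → (Fin 3 → ℝ) → ℝ)
    (t : (Fin 3 → ℝ) → ℝ) (K : ℝ) : Prop where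
  isOpen : IsOpen U
  a_ne : ∀ i, ∀ q ∈ U, a i q ≠ 0
  sum : ∀ i j k, Cyc i j k → ∀ q ∈ U, a k q = -a i q - a j q
  p_cont : ∀ i, ContinuousOn (p i) U
  s_eq : ∀ i, ∀ q ∈ U, p i q = 0 → s i q = 0
  dp : ∀ i, ∀ q ∈ U, ∃ w, w ≠ 0 ∧ HasPD i (p i) (w * F i q) q
  da_off : ∀ i j, i ≠ j → ∀ q ∈ U, HasPD j (a i) (2 * p j q * a i q ^ 3) q
  da_diag : ∀ i j k, Cyc i j k → ∀ q ∈ U, HasPD i (a i)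
    (2 * p i q * a i q * (a j q ^ 2 - a j q * a k q + a k q ^ 2)) q
  ds_off : ∀ i j k, i ≠ j → j ≠ k → i ≠ k → ∀ q ∈ U, HasPD j (s i)
    (2 * p j q * s i q * (a j q ^ 2 - 2 * a i q ^ 2 - 5 * a k q ^ 2)) q
  ds_diag : ∀ i j k, Cyc i j k → ∀ q ∈ U, HasPD i (s i)
    (2 * p i q * (F i q - 3 * (a j q ^ 2 - a j q * a k q + a k q ^ 2) * s i q)) q
  dt : ∀ i j k, Cyc i j k → ∀ q ∈ U, HasPD i t
    (-(t q * p i q * (2 * a j q ^ 2 - a j q * a k q + 2 * a k q ^ 2))) q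
  dF : ∀ i j k, i ≠ j → j ≠ k → i ≠ k → ∀ q ∈ U, HasPD j (F i)
    (p j q * (s i q * ((a i q ^ 2 + a j q ^ 2 - 5 * a k q ^ 2) ^ 2
        + 4 * a i q ^ 2 * (a j q ^ 2 - a j q * a k q + a k q ^ 2)
        + 4 * a j q ^ 4 - 20 * a k q ^ 4)
      - (5 * a i q ^ 2 - a j q ^ 2 + 5 * a k q ^ 2) * F i q)) q
  gauss : ∀ i j k, Cyc i j k → ∀ q ∈ U,
    F i q + F j q + s i q * (4 * a j q ^ 2 + a j q * a k q - a k q ^ 2)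
      + s j q * (4 * a i q ^ 2 + a i q * a k q - a k q ^ 2) + s k q * a k q ^ 2
      + gaussTerm (a i q) (a j q) (a k q) (t q) K = 0

/-- The derivative of `gaussTerm` along a curve with velocity `(x', y', z', t')`. -/
def gaussTermDeriv (x y z t K x' y' z' t' : ℝ) : ℝ :=
  (-((y' - z') * (z - x) + (y - z) * (z' - x')) / (9 * (x * (y * z)))
    + (y - z) * (z - x) * (x' / x + y' / y + z' / z) / (9 * (x * (y * z)))
    - ((x' - y') * t + (x - y) * t') / 3) / (x ^ 2 * y ^ 2)
    - 2 * (x' / x + y' / y) * gaussTerm x y z t K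

theorem hasPD_gaussTerm {i : Fin 3} {q : Fin 3 → ℝ} {x y z t : (Fin 3 → ℝ) → ℝ}
    {x' y' z' t' : ℝ} (K : ℝ) (hx : HasPD i x x' q) (hy : HasPD i y y' q) (hz : HasPD i z z' q)
    (ht : HasPD i t t' q) (x0 : x q ≠ 0) (y0 : y q ≠ 0) (z0 : z q ≠ 0) :
    HasPD i (fun u => gaussTerm (x u) (y u) (z u) (t u) K)
      (gaussTermDeriv (x q) (y q) (z q) (t q) K x' y' z' t') q := by
  convert ((((((hy.sub hz).mul (hz.sub hx)).neg.div ((hx.mul (hy.mul hz)).smul 9)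
    (by simp [x0, y0, z0])).sub (((hx.sub hy).mul ht).div (.const 3) (by norm_num))).add
    (.const K)).div ((hx.pow 2).mul (hy.pow 2)) (by simp [x0, y0])) using 1
  · rfl
  · simp only [gaussTerm, gaussTermDeriv]
    field_simp
    ring

namespace Reduced

variable {U : Set (Fin 3 → ℝ)} {a p s F : Fin 3 → (Fin 3 → ℝ) → ℝ}
    {t : (Fin 3 → ℝ) → ℝ} {K : ℝ}

/-- The three Gauss equations solved for `F_i`. -/
theorem two_mul_F (R : Reduced U a p s F t K) {i j k : Fin 3} (h : Cyc i j k)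
    {q : Fin 3 → ℝ} (hq : q ∈ U) :
    2 * F i q + 2 * (s i q * (a j q ^ 2 + a k q ^ 2))
      + s j q * (5 * a i q ^ 2 + a j q ^ 2 - 5 * a k q ^ 2)
      + s k q * (5 * a i q ^ 2 + a k q ^ 2 - 5 * a j q ^ 2)
      + gaussTerm (a i q) (a j q) (a k q) (t q) K
      + gaussTerm (a k q) (a i q) (a j q) (t q) K
      - gaussTerm (a j q) (a k q) (a i q) (t q) K = 0 := by
  have e1 := R.gauss i j k h q hq
  have e2 := R.gauss j k i h.rot q hq
  have e3 := R.gauss k i j h.rot.rot q hq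
  have hs := R.sum j k i h.rot q hq
  rw [hs] at e1 e2 e3 ⊢
  linear_combination e1 + e3 - e2

theorem deriv_two_mul_F (R : Reduced U a p s F t K) {i j k : Fin 3} (h : Cyc i j k)
    {q : Fin 3 → ℝ} (hq : q ∈ U) {r : Fin 3} {Fi' si' sj' sk' ai' aj' ak' t' : ℝ}
    (dF : HasPD r (F i) Fi' q) (dsi : HasPD r (s i) si' q) (dsj : HasPD r (s j) sj' q)
    (dsk : HasPD r (s k) sk' q) (dai : HasPD r (a i) ai' q) (daj : HasPD r (a j) aj' q)
    (dak : HasPD r (a k) ak' q) (dt : HasPD r t t' q) :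
    2 * Fi' + 2 * (si' * (a j q ^ 2 + a k q ^ 2)
        + s i q * (2 * a j q * aj' + 2 * a k q * ak'))
      + (sj' * (5 * a i q ^ 2 + a j q ^ 2 - 5 * a k q ^ 2)
        + s j q * (10 * a i q * ai' + 2 * a j q * aj' - 10 * a k q * ak'))
      + (sk' * (5 * a i q ^ 2 + a k q ^ 2 - 5 * a j q ^ 2)
        + s k q * (10 * a i q * ai' + 2 * a k q * ak' - 10 * a j q * aj'))
      + gaussTermDeriv (a i q) (a j q) (a k q) (t q) K ai' aj' ak' t'
      + gaussTermDeriv (a k q) (a i q) (a j q) (t q) K ak' ai' aj' t'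
      - gaussTermDeriv (a j q) (a k q) (a i q) (t q) K aj' ak' ai' t' = 0 := by
  have hi := R.a_ne i q hq
  have hj := R.a_ne j q hq
  have hk := R.a_ne k q hq
  have e := HasPD.eq_zero ((((((dF.smul 2).add
      ((dsi.mul ((daj.pow 2).add (dak.pow 2))).smul 2)).add
      (dsj.mul ((((dai.pow 2).smul 5).add (daj.pow 2)).sub ((dak.pow 2).smul 5)))).add
      (dsk.mul ((((dai.pow 2).smul 5).add (dak.pow 2)).sub ((daj.pow 2).smul 5)))).add
      (hasPD_gaussTerm K dai daj dak dt hi hj hk)).add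
      (hasPD_gaussTerm K dak dai daj dt hk hi hj) |>.sub
      (hasPD_gaussTerm K daj dak dai dt hj hk hi))
      R.isOpen hq (fun _ hx => R.two_mul_F h hx)
  norm_num at e
  linear_combination e

/-- Differentiating `two_mul_F` for `F_i` along `u_j` and for `F_j` along `u_i`, and comparing with
the compatibility conditions `dF`, leaves a relation between `t` and `K` alone. -/
theorem integrability (R : Reduced U a p s F t K) {i j k : Fin 3} (h : Cyc i j k)
    {q : Fin 3 → ℝ} (hq : q ∈ U) (hi : p i q ≠ 0) (hj : p j q ≠ 0) :
    24 * K = 7 * t q * (a i q - a j q) := by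
  obtain ⟨hij, hjk, hik⟩ := h.distinct
  have e1 := R.deriv_two_mul_F h hq (R.dF i j k hij hjk hik q hq) (R.ds_off i j k hij hjk hik q hq)
    (R.ds_diag j k i h.rot q hq) (R.ds_off k j i hjk.symm hij.symm hik.symm q hq)
    (R.da_off i j hij q hq) (R.da_diag j k i h.rot q hq) (R.da_off k j hjk.symm q hq)
    (R.dt j k i h.rot q hq)
  have e2 := R.deriv_two_mul_F h.rot hq (R.dF j i k hij.symm hik hjk q hq)
    (R.ds_off j i k hij.symm hik hjk q hq)
    (R.ds_off k i j hik.symm hij hjk.symm q hq) (R.ds_diag i j k h q hq)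
    (R.da_off j i hij.symm q hq) (R.da_off k i hik.symm q hq) (R.da_diag i j k h q hq)
    (R.dt i j k h q hq)
  have f1 := R.two_mul_F h hq
  have f2 := R.two_mul_F h.rot hq
  have ai := R.a_ne i q hq
  have aj := R.a_ne j q hq
  have ak := R.a_ne k q hq
  have hs := R.sum i j k h q hq
  rw [hs] at e1 e2 f1 f2
  have ak' : - a i q - a j q ≠ 0 := hs ▸ ak
  have ak2 : a i q + a j q ≠ 0 := fun h => ak' (by linarith)
  simp only [gaussTerm, gaussTermDeriv] at e1 e2 f1 f2
  generalize a i q = x at *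
  generalize a j q = y at *
  generalize p i q = pi at *
  generalize p j q = pj at *
  generalize s i q = si at *
  generalize s j q = sj at *
  generalize s k q = sk at *
  generalize F i q = Fi at *
  generalize F j q = Fj at *
  generalize t q = t at *
  field_simp at e1
  field_simp at e2
  field_simp at f1
  field_simp at f2
  have g1 := (mul_eq_zero.mp (e1.trans (mul_zero _))).resolve_left hj
  have g2 := (mul_eq_zero.mp (e2.trans (mul_zero _))).resolve_left hi
  have : x ^ 2 * y ^ 2 * (-x - y) ^ 3 * (24 * K - 7 * t * (x - y)) = 0 := by
    linear_combination 1 / 27 * (g1 + g2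
      + ((5 * x ^ 2 - y ^ 2 + 5 * (x + y) ^ 2)
        - (5 * y ^ 2 + x ^ 2 - 5 * (x + y) ^ 2)) * f1
      + ((5 * y ^ 2 - x ^ 2 + 5 * (x + y) ^ 2) - (5 * x ^ 2 + y ^ 2 - 5 * (x + y) ^ 2)) * f2)
  have hne : x ^ 2 * y ^ 2 * (-x - y) ^ 3 ≠ 0 := by positivity
  linarith [(mul_eq_zero.mp this).resolve_left hne]

/-- If two of the `p_i` are nonzero at a point, then `t` vanishes there and `K = 0`. -/
theorem eq_zero_of_two_ne (R : Reduced U a p s F t K) {i j k : Fin 3} (h : Cyc i j k)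
    {q : Fin 3 → ℝ} (hq : q ∈ U) (hi : p i q ≠ 0) (hj : p j q ≠ 0) : t q = 0 ∧ K = 0 := by
  obtain ⟨hij, hjk, hik⟩ := h.distinct
  have hW : IsOpen ((U ∩ p i ⁻¹' {0}ᶜ) ∩ (U ∩ p j ⁻¹' {0}ᶜ)) :=
    ((R.p_cont i).isOpen_inter_preimage R.isOpen isOpen_compl_singleton).inter
      ((R.p_cont j).isOpen_inter_preimage R.isOpen isOpen_compl_singleton)
  have e := HasPD.eq_zero ((((R.dt i j k h q hq).smul 7).mul
    ((R.da_diag i j k h q hq).sub (R.da_off j i hij.symm q hq))).sub (.const (24 * K)))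
    hW ⟨⟨hq, hi⟩, hq, hj⟩ fun x hx =>
      sub_eq_zero.mpr (R.integrability h hx.1.1 hx.1.2 hx.2.2).symm
  have aj := R.a_ne j q hq
  have ak := R.a_ne k q hq
  have hs : a i q = -a j q - a k q := R.sum j k i h.rot q hq
  have ht : t q = 0 := by
    rw [hs] at e
    have : p i q * a j q * a k q ^ 2 * t q = 0 := by linear_combination 1 / 21 * e
    simpa [hi, aj, ak] using this
  refine ⟨ht, ?_⟩
  have := R.integrability h hq hi hj
  rw [ht] at this
  linarith

/-- If `p_i` vanishes on an open set, then so does `F_i`. -/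
theorem F_eq_zero (R : Reduced U a p s F t K) {W : Set (Fin 3 → ℝ)} (hW : IsOpen W)
    (hWU : W ⊆ U) {i : Fin 3} (h : ∀ q ∈ W, p i q = 0) {q : Fin 3 → ℝ} (hq : q ∈ W) :
    F i q = 0 := by
  obtain ⟨w, hw, hd⟩ := R.dp i q (hWU hq)
  exact (mul_eq_zero.mp (hd.eq_zero hW hq h)).resolve_left hw

/-- The `p_i` do not all vanish on a nonempty open set. -/
theorem not_all_zero (R : Reduced U a p s F t K) {W : Set (Fin 3 → ℝ)} (hW : IsOpen W)
    (hWU : W ⊆ U) {q : Fin 3 → ℝ} (hq : q ∈ W) : ∃ r ∈ W, ∃ i, p i r ≠ 0 := by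
  by_contra! hp
  have hs i : s i q = 0 := R.s_eq i q (hWU hq) (hp q hq i)
  have hF i : F i q = 0 := R.F_eq_zero hW hWU (fun r hr => hp r hr i) hq
  have e0 := R.gauss 0 1 2 (by decide) q (hWU hq)
  have e1 := R.gauss 1 2 0 (by decide) q (hWU hq)
  have e2 := R.gauss 2 0 1 (by decide) q (hWU hq)
  have h0 := R.a_ne 0 q (hWU hq)
  have h1 := R.a_ne 1 q (hWU hq)
  have h2 := R.a_ne 2 q (hWU hq)
  have hsum := R.sum 0 1 2 (by decide) q (hWU hq)
  simp only [hs, hF, gaussTerm] at e0 e1 e2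
  generalize a 0 q = x at *
  generalize a 1 q = y at *
  generalize a 2 q = z at *
  generalize t q = t at *
  field_simp at e0 e1 e2
  have d0 : x * (9 * x * y * z * t - 3 * (y - z)) = 0 := by
    subst hsum; linear_combination (e2 - e0) / 3
  have d1 : y * (9 * x * y * z * t - 3 * (z - x)) = 0 := by
    subst hsum; linear_combination (e0 - e1) / 3
  have d2 : z * (9 * x * y * z * t - 3 * (x - y)) = 0 := by
    subst hsum; linear_combination (e1 - e2) / 3
  have f0 := (mul_eq_zero.mp d0).resolve_left h0
  have f1 := (mul_eq_zero.mp d1).resolve_left h1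
  have f2 := (mul_eq_zero.mp d2).resolve_left h2
  exact h0 (by linarith)

/-- It is impossible that exactly one `p_i` is nonzero on an open set where `a_j ≠ a_k`. -/
theorem false_of_one_ne (R : Reduced U a p s F t K) {W : Set (Fin 3 → ℝ)} (hW : IsOpen W)
    (hWU : W ⊆ U) {i j k : Fin 3} (h : Cyc i j k) (hi : ∀ q ∈ W, p i q ≠ 0)
    (hj : ∀ q ∈ W, p j q = 0) (hk : ∀ q ∈ W, p k q = 0) (hne : ∀ q ∈ W, a k q ≠ a j q)
    {q : Fin 3 → ℝ} (hq : q ∈ W) : False := by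
  obtain ⟨hij, hjk, hik⟩ := h.distinct
  have da r (hr : r ∈ W) : HasPD i (a i) _ r := R.da_diag i j k h r (hWU hr)
  have db r (hr : r ∈ W) : HasPD i (a j) _ r := R.da_off j i hij.symm r (hWU hr)
  have dc r (hr : r ∈ W) : HasPD i (a k) _ r := R.da_off k i hik.symm r (hWU hr)
  have dt r (hr : r ∈ W) : HasPD i t _ r := R.dt i j k h r (hWU hr)
  have sum r (hr : r ∈ W) := R.sum j k i h.rot r (hWU hr)
  have hb r (hr : r ∈ W) := R.a_ne j r (hWU hr)
  have hc r (hr : r ∈ W) := R.a_ne k r (hWU hr)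
  have m0 : ∀ r ∈ W, 18 * K * ((a k r - a j r) * (a j r * a k r))
      + 3 * (t r * (a j r * a k r) * (2 * a j r ^ 2 - 3 * (a j r * a k r) + 2 * a k r ^ 2))
      + 4 * (a i r * (a k r - a j r)) = 0 := by
    intro r hr
    have e1 := R.two_mul_F h.rot (hWU hr)
    have e2 := R.two_mul_F h.rot.rot (hWU hr)
    have e3 := R.gauss j k i h.rot r (hWU hr)
    have ha := R.a_ne i r (hWU hr)
    have hb := hb r hr
    have hc := hc r hr
    have hs := sum r hr
    rw [R.F_eq_zero hW hWU hj hr, R.s_eq j r (hWU hr) (hj r hr),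
      R.s_eq k r (hWU hr) (hk r hr)] at e1
    rw [R.F_eq_zero hW hWU hk hr, R.s_eq j r (hWU hr) (hj r hr),
      R.s_eq k r (hWU hr) (hk r hr)] at e2
    rw [R.F_eq_zero hW hWU hj hr, R.F_eq_zero hW hWU hk hr, R.s_eq j r (hWU hr) (hj r hr),
      R.s_eq k r (hWU hr) (hk r hr)] at e3
    generalize a i r = x at *
    generalize a j r = y at *
    generalize a k r = z at *
    generalize t r = t at *
    have e4 : 5 * (y - z) * gaussTerm y z x t K
        + x * (gaussTerm x y z t K - gaussTerm z x y t K) = 0 := by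
      rw [hs] at e1 e2 e3 ⊢
      linear_combination (-y - z) / 2 * (e1 - e2) + 5 * (y - z) * e3
    have key : x * (18 * K * ((z - y) * (y * z))
        + 3 * (t * (y * z) * (2 * y ^ 2 - 3 * (y * z) + 2 * z ^ 2)) + 4 * (x * (z - y))) =
        -3 * x * y ^ 3 * z ^ 3 * (5 * (y - z) * gaussTerm y z x t K
        + x * (gaussTerm x y z t K - gaussTerm z x y t K)) := by
      simp only [gaussTerm]
      field_simp
      rw [hs]
      ring
    rw [e4, mul_zero] at key
    exact (mul_eq_zero.mp key).resolve_left ha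
  have m1 : ∀ r ∈ W, 3 * (t r * (a j r * a k r) *
      (4 * a j r ^ 2 - 13 * (a j r * a k r) + 4 * a k r ^ 2))
      - 8 * (a i r * (a k r - a j r)) = 0 := by
    intro r hr
    have e := HasPD.eq_zero ((((((dc r hr).sub (db r hr)).mul ((db r hr).mul (dc r hr))).smul
      (18 * K)).add ((((dt r hr).mul ((db r hr).mul (dc r hr))).mul
      (((((db r hr).pow 2).smul 2).sub (((db r hr).mul (dc r hr)).smul 3)).add
        (((dc r hr).pow 2).smul 2))).smul 3)).add
      (((da r hr).mul ((dc r hr).sub (db r hr))).smul 4)) hW hr m0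
    have e0 := m0 r hr
    rw [sum r hr] at e e0 ⊢
    norm_num at e
    have : p i r * (a j r * a k r) * (3 * (t r * (a j r * a k r) *
      (4 * a j r ^ 2 - 13 * (a j r * a k r) + 4 * a k r ^ 2))
      - 8 * ((-a j r - a k r) * (a k r - a j r))) = 0 := by
      linear_combination e - 2 * p i r * (2 * (a j r + a k r) ^ 2 - 3 * (a j r * a k r)) * e0
    simpa [hi r hr, hb r hr, hc r hr] using this
  have m2 : ∀ r ∈ W, 2 * a j r ^ 2 - 3 * (a j r * a k r) + 2 * a k r ^ 2 = 0 := by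
    intro r hr
    have e := HasPD.eq_zero (((((dt r hr).mul ((db r hr).mul (dc r hr))).mul
      (((((db r hr).pow 2).smul 4).sub (((db r hr).mul (dc r hr)).smul 13)).add
        (((dc r hr).pow 2).smul 4))).smul 3).sub
      (((da r hr).mul ((dc r hr).sub (db r hr))).smul 8)) hW hr m1
    have e0 := m1 r hr
    have ht : t r ≠ 0 := by
      intro ht
      have := R.a_ne i r (hWU hr)
      simp [ht, this, sub_ne_zero.mpr (hne r hr)] at e0
    rw [sum r hr] at e e0
    norm_num at e
    have : p i r * t r * (a j r * a k r) ^ 2 *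
        (2 * a j r ^ 2 - 3 * (a j r * a k r) + 2 * a k r ^ 2) = 0 := by
      linear_combination 1 / 45 * (e - 2 * p i r *
        (2 * (a j r + a k r) ^ 2 - 4 * (a j r * a k r)) * e0)
    simpa [hi r hr, ht, hb r hr, hc r hr] using this
  have e := HasPD.eq_zero (((((db q hq).pow 2).smul 2).sub
    (((db q hq).mul (dc q hq)).smul 3)).add (((dc q hq).pow 2).smul 2)) hW hq m2
  norm_num at e
  have : p i q * (a j q * a k q) ^ 2 = 0 := by
    linear_combination -1 / 7 * (e - 2 * p i q *
      (2 * (a j q + a k q) ^ 2 - 5 / 2 * (a j q * a k q)) * m2 q hq)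
  simp [hi q hq, hb q hq, hc q hq] at this

theorem exists_eq_zero (R : Reduced U a p s F t K) {W : Set (Fin 3 → ℝ)} (hW : IsOpen W)
    (hWU : W ⊆ U) (hne : ∀ q ∈ W, ∀ i j, i ≠ j → a i q ≠ a j q) (hW0 : W.Nonempty) :
    ∃ q ∈ W, t q = 0 ∧ K = 0 := by
  obtain ⟨q, hq⟩ := hW0
  obtain ⟨r, hr, i, hi⟩ := R.not_all_zero hW hWU hq
  by_contra! hcon
  have hp : ∀ x ∈ W, ∀ i j k, Cyc i j k → p i x ≠ 0 → p j x = 0 := by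
    intro x hx i j k h h1
    by_contra h2
    obtain ⟨h3, h4⟩ := R.eq_zero_of_two_ne h (hWU hx) h1 h2
    exact hcon x hx h3 h4
  have h := cyc_succ i
  refine R.false_of_one_ne (W := W ∩ (U ∩ p i ⁻¹' {0}ᶜ))
    (hW.inter ((R.p_cont i).isOpen_inter_preimage R.isOpen isOpen_compl_singleton))
    (fun x hx => hWU hx.1) h (fun x hx => hx.2.2) (fun x hx => hp x hx.1 _ _ _ h hx.2.2)
    (fun x hx => ?_) (fun x hx => hne x hx.1 _ _ h.rot.distinct.1.symm) ⟨hr, hWU hr, hi⟩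
  by_contra hc
  exact hx.2.2 (hp x hx.1 _ _ _ h.rot.rot hc)

end Reduced

theorem ContDiffOn.pd {U : Set (Fin 3 → ℝ)} {f : (Fin 3 → ℝ) → ℝ}
    (hf : ContDiffOn ℝ (⊤ : ℕ∞) f U) (hU : IsOpen U) (i : Fin 3) :
    ContDiffOn ℝ (⊤ : ℕ∞) (pd i f) U :=
  (hf.fderiv_of_isOpen hU (by simp)).clm_apply contDiffOn_const

theorem ContDiffOn.differentiableAt_of_isOpen {U : Set (Fin 3 → ℝ)} {f : (Fin 3 → ℝ) → ℝ}
    (hf : ContDiffOn ℝ (⊤ : ℕ∞) f U) (hU : IsOpen U) {q : Fin 3 → ℝ} (hq : q ∈ U) :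
    DifferentiableAt ℝ f q :=
  (hf.contDiffAt (hU.mem_nhds hq)).differentiableAt (by simp)

theorem ContDiffOn.pd_comm {U : Set (Fin 3 → ℝ)} {f : (Fin 3 → ℝ) → ℝ}
    (hf : ContDiffOn ℝ (⊤ : ℕ∞) f U) (hU : IsOpen U) {q : Fin 3 → ℝ} (hq : q ∈ U)
    (i j : Fin 3) : _root_.pd j (_root_.pd i f) q = _root_.pd i (_root_.pd j f) q := by
  have hd : DifferentiableAt ℝ (fderiv ℝ f) q :=
    ((hf.fderiv_of_isOpen hU (m := 1) (by norm_cast)).contDiffAt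
      (hU.mem_nhds hq)).differentiableAt (by simp)
  have hs : IsSymmSndFDerivAt ℝ f q :=
    (hf.contDiffAt (hU.mem_nhds hq)).isSymmSndFDerivAt (by
      simpa using WithTop.coe_le_coe.2 (le_top (a := (2 : ℕ∞))))
  have key (l m : Fin 3) : _root_.pd l (_root_.pd m f) q =
      fderiv ℝ (fderiv ℝ f) q (Pi.single l 1) (Pi.single m 1) := by
    have := hd.hasFDerivAt.clm_apply (hasFDerivAt_const (Pi.single m (1 : ℝ)) q)
    change fderiv ℝ (fun y => fderiv ℝ f y (Pi.single m 1)) q (Pi.single l 1) = _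
    simpa using congrArg (fun L => L (Pi.single l 1)) this.fderiv
  rw [key, key]
  exact hs _ _

/-- The functions `a = (v₁², -v₂², v₃²)`, whose sum vanishes under the ansatz. -/
def signedSq (v : Fin 3 → (Fin 3 → ℝ) → ℝ) (i : Fin 3) (q : Fin 3 → ℝ) : ℝ :=
  (![1, -1, 1] : Fin 3 → ℝ) i * v i q ^ 2

/-- The function `p_i` with `∂_i v_j = p_i a_j² v_j` for both `j ≠ i`. -/
def logRate (v : Fin 3 → (Fin 3 → ℝ) → ℝ) (i : Fin 3) (q : Fin 3 → ℝ) : ℝ :=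
  pd i (v (i + 1)) q / (v (i + 1) q * signedSq v (i + 1) q ^ 2)

namespace Hypo

variable {U : Set (Fin 3 → ℝ)} {v V : Fin 3 → (Fin 3 → ℝ) → ℝ} {c H : ℝ} {i j k : Fin 3}
  {q : Fin 3 → ℝ}

theorem v_ne (hyp : Hypo U v V c H) (i : Fin 3) (hq : q ∈ U) : v i q ≠ 0 :=
  (hyp.pos i q hq).ne'

theorem a_ne (hyp : Hypo U v V c H) (i : Fin 3) (hq : q ∈ U) : signedSq v i q ≠ 0 := by
  have := hyp.v_ne i hq
  fin_cases i <;> simpa [signedSq] using this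

theorem a_sum (hyp : Hypo U v V c H) (h : Cyc i j k) (hq : q ∈ U) :
    signedSq v k q = -signedSq v i q - signedSq v j q := by
  obtain ⟨rfl, rfl⟩ := h
  have := hyp.ansatz_v q hq
  fin_cases i <;> simp [signedSq] <;> linarith

theorem prod_sq (v : Fin 3 → (Fin 3 → ℝ) → ℝ) (h : Cyc i j k) (q : Fin 3 → ℝ) :
    signedSq v i q * signedSq v j q * signedSq v k q = -(v i q * v j q * v k q) ^ 2 := by
  obtain ⟨rfl, rfl⟩ := h
  fin_cases i <;> simp [signedSq] <;> ring

theorem prod_eq (v : Fin 3 → (Fin 3 → ℝ) → ℝ) (h : Cyc i j k) (q : Fin 3 → ℝ) :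
    v 0 q * v 1 q * v 2 q = v i q * v j q * v k q := by
  obtain ⟨rfl, rfl⟩ := h
  fin_cases i <;> simp <;> ring

theorem V_eq (hyp : Hypo U v V c H) (h : Cyc i j k) (hq : q ∈ U) :
    V i q = (signedSq v j q - signedSq v k q) / (3 * (v j q * v k q)) + H / 3 * v i q := by
  obtain ⟨rfl, rfl⟩ := h
  have h0 := hyp.v_ne 0 hq
  have h1 := hyp.v_ne 1 hq
  have h2 := hyp.v_ne 2 hq
  have e0 := hyp.ansatz_V1 q hq
  have e1 := hyp.ansatz_V2 q hq
  have e2 := hyp.ansatz_V3 q hq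
  fin_cases i <;> simp [signedSq, e0, e1, e2] <;> field_simp <;> ring

theorem hasPD_v (hyp : Hypo U v V c H) (i j : Fin 3) (hq : q ∈ U) :
    HasPD i (v j) (pd i (v j) q) q :=
  ((hyp.smooth_v j).differentiableAt_of_isOpen hyp.hopen hq).hasPD i

theorem hasPD_a (hyp : Hypo U v V c H) (i j : Fin 3) (hq : q ∈ U) :
    HasPD i (signedSq v j) (2 * signedSq v j q * (pd i (v j) q / v j q)) q := by
  have := hyp.v_ne j hq
  convert ((hyp.hasPD_v i j hq).pow 2).smul ((![1, -1, 1] : Fin 3 → ℝ) j) using 1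
  · rfl
  · simp only [signedSq]
    field_simp
    ring

theorem a_logDeriv_sum (hyp : Hypo U v V c H) (h : Cyc i j k) (l : Fin 3) (hq : q ∈ U) :
    signedSq v i q * (pd l (v i) q / v i q) + signedSq v j q * (pd l (v j) q / v j q)
      + signedSq v k q * (pd l (v k) q / v k q) = 0 := by
  have := HasPD.eq_zero (((hyp.hasPD_a l k hq).add (hyp.hasPD_a l i hq)).add
    (hyp.hasPD_a l j hq)) hyp.hopen hq fun x hx => by rw [hyp.a_sum h hx]; ring
  linear_combination this / 2

theorem logDeriv_cross (hyp : Hypo U v V c H) (h : Cyc i j k) (hq : q ∈ U) :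
    signedSq v j q ^ 2 * (pd i (v k) q / v k q) =
      signedSq v k q ^ 2 * (pd i (v j) q / v j q) := by
  obtain ⟨hij, hjk, hik⟩ := h.distinct
  have hi := hyp.v_ne i hq
  have hj := hyp.v_ne j hq
  have hk := hyp.v_ne k hq
  have ha := hyp.a_ne i hq
  have e1 := hyp.holiv j i hij.symm q hq
  have e2 : pd i (V j) q = _ := HasPD.unique
    (((hyp.smooth_V j).differentiableAt_of_isOpen hyp.hopen hq).hasPD i)
    (HasPD.congr (((((hyp.hasPD_a i k hq).sub (hyp.hasPD_a i i hq)).div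
      (((hyp.hasPD_v i k hq).mul (hyp.hasPD_v i i hq)).smul 3) (by simp [hi, hk])).add
      ((hyp.hasPD_v i j hq).smul (H / 3)))) hyp.hopen hq fun x hx => hyp.V_eq h.rot hx)
  have e3 := hyp.a_logDeriv_sum h i hq
  have hs := hyp.a_sum h.rot hq
  rw [e2, hh, hyp.V_eq h hq] at e1
  generalize signedSq v i q = x at *
  generalize signedSq v j q = y at *
  generalize signedSq v k q = z at *
  obtain ⟨X, hX⟩ : ∃ X, X = pd i (v i) q / v i q := ⟨_, rfl⟩
  obtain ⟨Y, hY⟩ : ∃ Y, Y = pd i (v j) q / v j q := ⟨_, rfl⟩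
  obtain ⟨Z, hZ⟩ : ∃ Z, Z = pd i (v k) q / v k q := ⟨_, rfl⟩
  have hX' : pd i (v i) q = X * v i q := by rw [hX]; field_simp
  have hY' : pd i (v j) q = Y * v j q := by rw [hY]; field_simp
  have hZ' : pd i (v k) q = Z * v k q := by rw [hZ]; field_simp
  rw [← hX, ← hY, ← hZ] at e3
  rw [← hY, ← hZ]
  rw [← hX, ← hZ, hX', hY', hZ'] at e1
  field_simp at e1
  subst hs
  linear_combination -(y + z) * e1 - y * e3

theorem pd_v (hyp : Hypo U v V c H) (hij : i ≠ j) (hq : q ∈ U) :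
    pd i (v j) q = logRate v i q * signedSq v j q ^ 2 * v j q := by
  have hc := hyp.logDeriv_cross (cyc_succ i) hq
  have h1 := hyp.v_ne (i + 1) hq
  have h2 := hyp.v_ne (i + 2) hq
  have h3 := hyp.a_ne (i + 1) hq
  rcases (by decide : ∀ {i j : Fin 3}, i ≠ j → j = i + 1 ∨ j = i + 2) hij with rfl | rfl
  · rw [logRate]
    field_simp
  · rw [logRate]
    field_simp at hc ⊢
    linear_combination hc

theorem pd_v_self (hyp : Hypo U v V c H) (h : Cyc i j k) (hq : q ∈ U) :
    pd i (v i) q = logRate v i q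
      * (signedSq v j q ^ 2 - signedSq v j q * signedSq v k q + signedSq v k q ^ 2) * v i q := by
  obtain ⟨hij, hjk, hik⟩ := h.distinct
  have hi := hyp.v_ne i hq
  have hj := hyp.v_ne j hq
  have hk := hyp.v_ne k hq
  have ha := hyp.a_ne i hq
  have e := hyp.a_logDeriv_sum h i hq
  rw [hyp.pd_v hij hq, hyp.pd_v hik hq, mul_div_cancel_right₀ _ hj,
    mul_div_cancel_right₀ _ hk] at e
  have hs := hyp.a_sum h.rot hq
  have : signedSq v i q * (pd i (v i) q / v i q) = signedSq v i q * (logRate v i q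
      * (signedSq v j q ^ 2 - signedSq v j q * signedSq v k q + signedSq v k q ^ 2)) := by
    nth_rw 2 [hs]
    linear_combination e
  rw [← mul_left_cancel₀ ha this]
  field_simp

theorem contDiffOn_logRate (hyp : Hypo U v V c H) (i : Fin 3) :
    ContDiffOn ℝ (⊤ : ℕ∞) (logRate v i) U := by
  have hv := hyp.smooth_v (i + 1)
  refine (hv.pd hyp.hopen i).div (hv.mul ((contDiffOn_const.mul (hv.pow 2)).pow 2)) ?_
  intro x hx
  exact mul_ne_zero (hyp.v_ne _ hx) (pow_ne_zero 2 (hyp.a_ne _ hx))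

theorem hasPD_v_off (hyp : Hypo U v V c H) (hij : i ≠ j) (hq : q ∈ U) :
    HasPD i (v j) (logRate v i q * signedSq v j q ^ 2 * v j q) q :=
  hyp.pd_v hij hq ▸ hyp.hasPD_v i j hq

theorem hasPD_v_diag (hyp : Hypo U v V c H) (hij : i ≠ j) (hjk : j ≠ k) (hik : i ≠ k)
    (hq : q ∈ U) : HasPD i (v i) (logRate v i q
      * (signedSq v j q ^ 2 - signedSq v j q * signedSq v k q + signedSq v k q ^ 2) * v i q) q := by
  rcases cyc_or_cyc_of_distinct hij hjk hik with h | h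
  · exact hyp.pd_v_self h hq ▸ hyp.hasPD_v i i hq
  · convert hyp.hasPD_v i i hq using 1
    rw [hyp.pd_v_self h hq]
    ring

theorem hasPD_a_off (hyp : Hypo U v V c H) (hij : i ≠ j) (hq : q ∈ U) :
    HasPD i (signedSq v j) (2 * logRate v i q * signedSq v j q ^ 3) q := by
  convert hyp.hasPD_a i j hq using 1
  rw [hyp.pd_v hij hq, mul_div_cancel_right₀ _ (hyp.v_ne j hq)]
  ring

theorem hasPD_a_diag (hyp : Hypo U v V c H) (hij : i ≠ j) (hjk : j ≠ k) (hik : i ≠ k)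
    (hq : q ∈ U) : HasPD i (signedSq v i) (2 * logRate v i q * signedSq v i q
      * (signedSq v j q ^ 2 - signedSq v j q * signedSq v k q + signedSq v k q ^ 2)) q := by
  convert hyp.hasPD_a i i hq using 1
  rw [(hyp.hasPD_v i i hq).unique (hyp.hasPD_v_diag hij hjk hik hq),
    mul_div_cancel_right₀ _ (hyp.v_ne i hq)]
  ring

theorem hasPD_logRate (hyp : Hypo U v V c H) (i j : Fin 3) (hq : q ∈ U) :
    HasPD j (logRate v i) (pd j (logRate v i) q) q :=
  ((hyp.contDiffOn_logRate i).differentiableAt_of_isOpen hyp.hopen hq).hasPD j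

theorem hh_eq (hyp : Hypo U v V c H) (hij : i ≠ j) (hq : q ∈ U) :
    hh v i j q = logRate v i q * signedSq v j q ^ 2 * v j q / v i q := by
  rw [hh, hyp.pd_v hij hq]
  ring

theorem differentiableAt_hh (hyp : Hypo U v V c H) (i j : Fin 3) (hq : q ∈ U) :
    DifferentiableAt ℝ (hh v i j) q :=
  (contDiffOn_const.div (hyp.smooth_v i) fun _ hx => hyp.v_ne i hx).mul
    ((hyp.smooth_v j).pd hyp.hopen i) |>.differentiableAt_of_isOpen hyp.hopen hq

theorem pd_logRate (hyp : Hypo U v V c H) (hij : i ≠ j) (hjk : j ≠ k) (hik : i ≠ k)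
    (hq : q ∈ U) : pd j (logRate v i) q = logRate v i q * logRate v j q
      * (signedSq v i q ^ 2 + signedSq v j q ^ 2 - 5 * signedSq v k q ^ 2) := by
  have hi := hyp.v_ne i hq
  have hj := hyp.v_ne j hq
  have hk := hyp.v_ne k hq
  have ha := hyp.a_ne k hq
  have e := hyp.holii i j k hij hjk hik q hq
  rw [((hyp.differentiableAt_hh i k hq).hasPD j).unique
    (((((hyp.hasPD_logRate i j hq).mul ((hyp.hasPD_a_off hjk hq).pow 2)).mul
      (hyp.hasPD_v_off hjk hq)).div (hyp.hasPD_v_off hij.symm hq) hi).congr hyp.hopen hq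
      fun x hx => hyp.hh_eq hik hx), hyp.hh_eq hij hq, hyp.hh_eq hjk hq] at e
  push_cast at e
  field_simp at e
  linear_combination e

theorem hasPD_norm_off (hyp : Hypo U v V c H) (hij : i ≠ j) (hq : q ∈ U) :
    HasPD j (fun x => v i x ^ 2 * signedSq v i x ^ 2)
      (6 * logRate v j q * signedSq v i q ^ 2 * (v i q ^ 2 * signedSq v i q ^ 2)) q := by
  convert ((hyp.hasPD_v_off hij.symm hq).pow 2).mul ((hyp.hasPD_a_off hij.symm hq).pow 2) using 1
  push_cast
  ring

theorem hasPD_norm_diag (hyp : Hypo U v V c H) (hij : i ≠ j) (hjk : j ≠ k) (hik : i ≠ k)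
    (hq : q ∈ U) : HasPD i (fun x => v i x ^ 2 * signedSq v i x ^ 2)
      (6 * logRate v i q
        * (signedSq v j q ^ 2 - signedSq v j q * signedSq v k q + signedSq v k q ^ 2)
        * (v i q ^ 2 * signedSq v i q ^ 2)) q := by
  convert ((hyp.hasPD_v_diag hij hjk hik hq).pow 2).mul
    ((hyp.hasPD_a_diag hij hjk hik hq).pow 2) using 1
  push_cast
  ring

theorem norm_ne (hyp : Hypo U v V c H) (i : Fin 3) (hq : q ∈ U) :
    v i q ^ 2 * signedSq v i q ^ 2 ≠ 0 :=
  mul_ne_zero (pow_ne_zero 2 (hyp.v_ne i hq)) (pow_ne_zero 2 (hyp.a_ne i hq))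

theorem hasPD_pd_logRate (hyp : Hypo U v V c H) (hij : i ≠ j) (hjk : j ≠ k) (hik : i ≠ k)
    (hq : q ∈ U) : HasPD j (pd i (logRate v i)) (logRate v j q * (pd i (logRate v i) q
        * (signedSq v i q ^ 2 + signedSq v j q ^ 2 - 5 * signedSq v k q ^ 2)
      + logRate v i q ^ 2
        * ((signedSq v i q ^ 2 + signedSq v j q ^ 2 - 5 * signedSq v k q ^ 2) ^ 2
          + 4 * signedSq v i q ^ 2
            * (signedSq v j q ^ 2 - signedSq v j q * signedSq v k q + signedSq v k q ^ 2)
          + 4 * signedSq v j q ^ 4 - 20 * signedSq v k q ^ 4))) q := by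
  have hp := hyp.contDiffOn_logRate i
  convert ((hp.pd hyp.hopen i).differentiableAt_of_isOpen hyp.hopen hq).hasPD j using 1
  rw [hp.pd_comm hyp.hopen hq i j,
    (((hp.pd hyp.hopen j).differentiableAt_of_isOpen hyp.hopen hq).hasPD i).unique
      ((((hyp.hasPD_logRate i i hq).mul (hyp.hasPD_logRate j i hq)).mul
        ((((hyp.hasPD_a_diag hij hjk hik hq).pow 2).add ((hyp.hasPD_a_off hij hq).pow 2)).sub
          (((hyp.hasPD_a_off hik hq).pow 2).smul 5))).congr hyp.hopen hq
        fun x hx => hyp.pd_logRate hij hjk hik hx),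
    hyp.pd_logRate hij.symm hik hjk hq]
  push_cast
  ring

theorem pd_hh_diag (hyp : Hypo U v V c H) (hij : i ≠ j) (hjk : j ≠ k) (hik : i ≠ k)
    (hq : q ∈ U) : pd i (hh v i j) q = signedSq v j q ^ 2 * v j q / v i q
      * (pd i (logRate v i) q + logRate v i q ^ 2
        * (4 * signedSq v j q ^ 2 + signedSq v j q * signedSq v k q - signedSq v k q ^ 2)) := by
  have hi := hyp.v_ne i hq
  rw [((hyp.differentiableAt_hh i j hq).hasPD i).unique
    (((((hyp.hasPD_logRate i i hq).mul ((hyp.hasPD_a_off hij hq).pow 2)).mul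
      (hyp.hasPD_v_off hij hq)).div (hyp.hasPD_v_diag hij hjk hik hq) hi).congr hyp.hopen hq
      fun x hx => hyp.hh_eq hij hx)]
  field_simp
  push_cast
  ring

theorem gauss_eq (hyp : Hypo U v V c H) (h : Cyc i j k) (hq : q ∈ U) :
    pd i (logRate v i) q / (v i q ^ 2 * signedSq v i q ^ 2)
      + pd j (logRate v j) q / (v j q ^ 2 * signedSq v j q ^ 2)
      + logRate v i q ^ 2 / (v i q ^ 2 * signedSq v i q ^ 2)
        * (4 * signedSq v j q ^ 2 + signedSq v j q * signedSq v k q - signedSq v k q ^ 2)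
      + logRate v j q ^ 2 / (v j q ^ 2 * signedSq v j q ^ 2)
        * (4 * signedSq v i q ^ 2 + signedSq v i q * signedSq v k q - signedSq v k q ^ 2)
      + logRate v k q ^ 2 / (v k q ^ 2 * signedSq v k q ^ 2) * signedSq v k q ^ 2
      + gaussTerm (signedSq v i q) (signedSq v j q) (signedSq v k q)
        (H / 3 / (v 0 q * v 1 q * v 2 q)) (H ^ 2 / 9 + c) = 0 := by
  obtain ⟨hij, hjk, hik⟩ := h.distinct
  have hi := hyp.v_ne i hq
  have hj := hyp.v_ne j hq
  have hk := hyp.v_ne k hq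
  have ai := hyp.a_ne i hq
  have aj := hyp.a_ne j hq
  have ak := hyp.a_ne k hq
  have e := hyp.holiii i j k hij hjk hik q hq
  have hV : gaussTerm (signedSq v i q) (signedSq v j q) (signedSq v k q)
      (H / 3 / (v 0 q * v 1 q * v 2 q)) (H ^ 2 / 9 + c) =
      (V i q * V j q + c * v i q * v j q)
        / (v i q * v j q * signedSq v i q ^ 2 * signedSq v j q ^ 2) := by
    rw [gaussTerm, prod_eq v h, ← mul_assoc (signedSq v i q), prod_sq v h, hyp.V_eq h hq,
      hyp.V_eq h.rot hq]
    field_simp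
    ring
  rw [hyp.pd_hh_diag hij hjk hik hq, hyp.pd_hh_diag hij.symm hik hjk hq, hyp.hh_eq hik.symm hq,
    hyp.hh_eq hjk.symm hq] at e
  rw [hV]
  have hne : v i q * v j q * signedSq v i q ^ 2 * signedSq v j q ^ 2 ≠ 0 := by positivity
  refine mul_left_cancel₀ hne ?_
  rw [mul_zero, ← e, mul_add, mul_div_cancel₀ _ hne]
  field_simp
  ring

/-- The holonomic system with the ansatz, in the unknowns `a_i` and `p_i`. -/
theorem reduced (hyp : Hypo U v V c H) :
    Reduced U (signedSq v) (logRate v)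
      (fun i q => logRate v i q ^ 2 / (v i q ^ 2 * signedSq v i q ^ 2))
      (fun i q => pd i (logRate v i) q / (v i q ^ 2 * signedSq v i q ^ 2))
      (fun q => H / 3 / (v 0 q * v 1 q * v 2 q)) (H ^ 2 / 9 + c) where
  isOpen := hyp.hopen
  a_ne i q hq := hyp.a_ne i hq
  sum i j k h q hq := hyp.a_sum h hq
  p_cont i := (hyp.contDiffOn_logRate i).continuousOn
  s_eq i q _ h := by simp [h]
  dp i q hq := ⟨_, hyp.norm_ne i hq, by
    convert hyp.hasPD_logRate i i hq using 1
    exact mul_div_cancel₀ _ (hyp.norm_ne i hq)⟩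
  da_off i j hij q hq := hyp.hasPD_a_off hij.symm hq
  da_diag i j k h q hq := hyp.hasPD_a_diag h.distinct.1 h.distinct.2.1 h.distinct.2.2 hq
  ds_off i j k hij hjk hik q hq := by
    have h0 := hyp.norm_ne i hq
    convert ((hyp.hasPD_logRate i j hq).pow 2).div (hyp.hasPD_norm_off hij hq) h0 using 1
    rw [hyp.pd_logRate hij hjk hik hq]
    have hv := hyp.v_ne i hq
    have ha := hyp.a_ne i hq
    push_cast
    field_simp
    ring
  ds_diag i j k h q hq := by
    obtain ⟨hij, hjk, hik⟩ := h.distinct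
    have h0 := hyp.norm_ne i hq
    convert ((hyp.hasPD_logRate i i hq).pow 2).div (hyp.hasPD_norm_diag hij hjk hik hq) h0 using 1
    have hv := hyp.v_ne i hq
    have ha := hyp.a_ne i hq
    push_cast
    field_simp
    ring
  dt i j k h q hq := by
    obtain ⟨hij, hjk, hik⟩ := h.distinct
    have hi := hyp.v_ne i hq
    have hj := hyp.v_ne j hq
    have hk := hyp.v_ne k hq
    have := (HasPD.const (H / 3)).div (((hyp.hasPD_v_diag hij hjk hik hq).mul
      (hyp.hasPD_v_off hij hq)).mul (hyp.hasPD_v_off hik hq)) (by positivity)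
    simp_rw [prod_eq v h]
    convert this using 1
    field_simp
    ring
  dF i j k hij hjk hik q hq := by
    have h0 := hyp.norm_ne i hq
    convert (hyp.hasPD_pd_logRate hij hjk hik hq).div (hyp.hasPD_norm_off hij hq) h0 using 1
    have hv := hyp.v_ne i hq
    have ha := hyp.a_ne i hq
    field_simp
    ring
  gauss i j k h q hq := hyp.gauss_eq h hq

end Hypo

theorem statement_9 (U : Set (Fin 3 → ℝ)) (v V : Fin 3 → (Fin 3 → ℝ) → ℝ) (c H : ℝ)
    (hyp : Hypo U v V c H) : (∃ p ∈ U, v 0 p ≠ v 2 p) → H = 0 ∧ c = 0 := by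
  rintro ⟨p, hp, hne⟩
  obtain ⟨q, hq, ht, hK⟩ := hyp.reduced.exists_eq_zero (W := U ∩ {q | v 0 q - v 2 q ≠ 0})
    (((hyp.smooth_v 0).continuousOn.sub (hyp.smooth_v 2).continuousOn).isOpen_inter_preimage
      hyp.hopen isOpen_ne) Set.inter_subset_left (fun q hq => by
      have h0 := hyp.pos 0 q hq.1
      have h1 := hyp.pos 1 q hq.1
      have h2 := hyp.pos 2 q hq.1
      have hn : v 0 q - v 2 q ≠ 0 := hq.2
      have h02 : v 0 q ^ 2 ≠ v 2 q ^ 2 := fun h =>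
        hn (sub_eq_zero.2 ((pow_left_inj₀ h0.le h2.le two_ne_zero).1 h))
      have h01 : -v 1 q ^ 2 ≠ v 0 q ^ 2 := by
        nlinarith
      have h12 : -v 1 q ^ 2 ≠ v 2 q ^ 2 := by
        nlinarith
      intro i j hij
      fin_cases i <;> fin_cases j <;>
        simp [signedSq, h01, h02, h12, h01.symm, h02.symm, h12.symm] at hij ⊢)
    ⟨p, hp, sub_ne_zero.2 hne⟩
  have hH : H = 0 := by
    simpa [hyp.v_ne _ hq.1] using ht
  exact ⟨hH, by simpa [hH] using hK⟩
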